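/- Suppose that the finite group G acts transitively, faithfully and with fixity 4 on a finite set Ω, let P be a Sylow 3-subgroup of G, let Δ denote the union of the P-orbits on Ω of length at most 3, and assume that 1 ≤ |Δ| ≤ 4 and that P acts freely on Ω ∖ Δ. Let K be the setwise stabilizer of Δ in G. Then one of the following is true: (a) K is strongly 3-embedded in G; (b) G contains a normal subgroup N of index 3 such that N ∩ K is strongly 3-embedded in N; (c) for every α ∈ Ω the stabilizer G_α has even order. -/

import Mathlib

open Pointwise

/-- `M` is a strongly `p`-embedded subgroup of `N` (both subgroups of an ambient
group `G`): `M ≤ N`, `p` divides `|M|`, and for every `g ∈ N` with `g ∉ M`, `p` does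
not divide `|M ∩ gMg⁻¹|`. -/
def StronglyPEmbeddedIn {G : Type*} [Group G] (p : ℕ) (M N : Subgroup G) : Prop :=
  M ≤ N ∧ p ∣ Nat.card ↥M ∧
    ∀ g ∈ N, g ∉ M → ¬ p ∣ Nat.card ↥(M ⊓ M.map (MulAut.conj g).toMonoidHom)

universe u

section FixedPoints

open MulAction

/-- Every `p`-subgroup can be conjugated into a given Sylow `p`-subgroup. -/
lemma IsPGroup.exists_conj_mem_sylow {G : Type*} [Group G] [Finite G] {p : ℕ} [Fact p.Prime]
    (P : Sylow p G) {S : Subgroup G} (hS : IsPGroup p S) :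
    ∃ h : G, ∀ s ∈ S, h⁻¹ * s * h ∈ P := by
  obtain ⟨Q, hQ⟩ := hS.exists_le_sylow
  obtain ⟨h, rfl⟩ := exists_smul_eq G P Q
  refine ⟨h, fun s hs => ?_⟩
  have h1 : s ∈ MulAut.conj h • (P : Subgroup G) := hQ hs
  rw [Subgroup.mem_pointwise_smul_iff_inv_smul_mem] at h1
  have h2 : h⁻¹ * s * h ∈ (P : Subgroup G) := by
    simpa [← map_inv, MulAut.smul_def, MulAut.conj_apply] using h1
  exact h2

/-- A normal subgroup of a `p`-group of order divisible by `p` contains a nontrivial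
central element. -/
lemma IsPGroup.exists_mem_center_of_normal {H : Type*} [Group H] [Finite H] {p : ℕ}
    [Fact p.Prime] (hH : IsPGroup p H) (M : Subgroup H) [M.Normal] (hM : p ∣ Nat.card M) :
    ∃ z ∈ M, z ≠ 1 ∧ ∀ x : H, x * z = z * x := by
  have hH' : IsPGroup p (ConjAct H) := hH
  have h1 : (1 : M) ∈ fixedPoints (ConjAct H) M := fun g => smul_one g
  obtain ⟨z, hz, hz1⟩ := hH'.exists_fixed_point_of_prime_dvd_card_of_fixed_point M hM h1
  refine ⟨z, z.2, fun h => hz1 (Subtype.ext h.symm), fun x => ?_⟩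
  have := congrArg Subtype.val (hz (ConjAct.toConjAct x))
  rw [ConjAct.Subgroup.val_conj_smul, ConjAct.smul_def] at this
  simpa [mul_inv_eq_iff_eq_mul] using this

/-- If `A` has exponent `p` and `φ` is constant on the `G`-conjugates of `x` lying in `H`, where
`x ^ p = 1`, then the transfer of `φ` at `x` is `φ x ^ |G : H|`. -/
lemma MonoidHom.transfer_eq_pow_index {G : Type*} [Group G] {H : Subgroup G} [H.FiniteIndex]
    {A : Type*} [CommGroup A] (φ : H →* A) {p : ℕ} [Fact p.Prime] (hA : ∀ a : A, a ^ p = 1)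
    (x : H) (hx : x ^ p = 1)
    (hφ : ∀ (g : G) (hg : g⁻¹ * (x : G) * g ∈ H), φ ⟨_, hg⟩ = φ x) :
    φ.transfer (x : G) = φ x ^ H.index := by
  classical
  let := H.fintypeQuotientOfFiniteIndex
  have hxG : (x : G) ^ p = 1 := by exact_mod_cast congrArg Subtype.val hx
  rw [transfer_eq_prod_quotient_orbitRel_zpowers_quot, Subgroup.index_eq_sum_minimalPeriod H (x : G),
    ← Finset.prod_pow_eq_pow_sum]
  refine Finset.prod_congr rfl fun q _ => ?_
  have hper : Function.minimalPeriod ((x : G) • ·) q.out ∣ p := by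
    apply Function.IsPeriodicPt.minimalPeriod_dvd
    rw [Function.IsPeriodicPt, smul_iterate, hxG]
    exact one_smul _ _
  rcases (Nat.dvd_prime (Fact.out : p.Prime)).1 hper with h | h
  · simp only [h, pow_one]
    exact hφ _ _
  · simp only [h, hxG, hA]
    exact (congrArg φ (Subtype.ext (by simp))).trans (map_one φ)

section SylowAction

variable {G Ω : Type*} [Group G] [Finite G] [MulAction G Ω] {p : ℕ} [Fact p.Prime]
  (P : Sylow p G) {Δ : Set Ω}

/-- If `P` acts freely off `Δ`, then nontrivial elements of a common `p`-subgroup with `|Δ|` fixed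
points each have the same fixed points. -/
lemma fixedBy_eq_of_mem_isPGroup [Finite Ω]
    (hfree : ∀ ω ∉ Δ, ∀ g ∈ P, g • ω = ω → g = 1)
    {S : Subgroup G} (hS : IsPGroup p S) {z w : G} (hz : z ∈ S) (hw : w ∈ S)
    (hz1 : z ≠ 1) (hw1 : w ≠ 1) (hzΔ : (fixedBy Ω z).ncard = Δ.ncard)
    (hwΔ : (fixedBy Ω w).ncard = Δ.ncard) : fixedBy Ω z = fixedBy Ω w := by
  obtain ⟨h, hh⟩ := hS.exists_conj_mem_sylow P
  have key : ∀ s ∈ S, s ≠ 1 → (fixedBy Ω s).ncard = Δ.ncard → fixedBy Ω s = h • Δ := by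
    intro s hs hs1 hsΔ
    refine Set.eq_of_subset_of_ncard_le (fun ω hω => ?_) (by rw [hsΔ, Set.ncard_smul_set])
      (Set.toFinite _)
    rw [Set.mem_smul_set_iff_inv_smul_mem]
    by_contra hn
    have hsω : s • ω = ω := hω
    have := hfree _ hn _ (hh s hs) (by simp [mul_smul, hsω])
    apply hs1
    have h2 : s = h * (h⁻¹ * s * h) * h⁻¹ := by group
    rw [h2, this]
    group
  rw [key z hz hz1 hzΔ, key w hw hw1 hwΔ]

/-- If a nontrivial element `z` of the centre of `P` fixes exactly the points of `Δ`, and `P` acts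
freely off `Δ`, then the stabilizer of `Δ` controls fusion of elements of `P`. -/
lemma exists_mem_stabilizer_conj_eq [Finite Ω]
    (hfree : ∀ ω ∉ Δ, ∀ g ∈ P, g • ω = ω → g = 1)
    {z : G} (hzP : z ∈ P) (hz1 : z ≠ 1) (hzc : ∀ x ∈ P, x * z = z * x)
    (hzΔ : fixedBy Ω z = Δ) {x g : G} (hx : x ∈ P) (hg : g * x * g⁻¹ ∈ P) :
    ∃ k ∈ stabilizer G Δ, k * x * k⁻¹ = g * x * g⁻¹ := by
  set y := g * x * g⁻¹ with hy
  let C := Subgroup.centralizer ({y} : Set G)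
  have hzC : z ∈ C := Subgroup.mem_centralizer_singleton_iff.2 (hzc y hg).symm
  have hwC : g * z * g⁻¹ ∈ C := by
    refine Subgroup.mem_centralizer_singleton_iff.2 ?_
    have := hzc x hx
    calc g * z * g⁻¹ * y = g * (z * x) * g⁻¹ := by rw [hy]; group
      _ = g * (x * z) * g⁻¹ := by rw [this]
      _ = y * (g * z * g⁻¹) := by rw [hy]; group
  have hzp : ∃ k, z ^ p ^ k = 1 := by
    obtain ⟨k, hk⟩ := P.isPGroup' ⟨z, hzP⟩
    exact ⟨k, by simpa using congrArg Subtype.val hk⟩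
  have hpow : ∀ (w : C), (∃ k, w ^ p ^ k = 1) → IsPGroup p (Subgroup.zpowers w) := by
    rintro w ⟨k, hk⟩
    apply IsPGroup.of_card_dvd_pow (n := k)
    rw [Nat.card_zpowers]
    exact orderOf_dvd_of_pow_eq_one hk
  obtain ⟨k, hk⟩ := hzp
  obtain ⟨S, hS⟩ := (hpow ⟨z, hzC⟩ ⟨k, Subtype.ext (by simpa using hk)⟩).exists_le_sylow
  obtain ⟨c, hc⟩ := (hpow ⟨_, hwC⟩ ⟨k, Subtype.ext (by simp [conj_pow, hk])⟩).exists_conj_mem_sylow S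
  have hzS : z ∈ (S : Subgroup C).map C.subtype := ⟨_, hS (Subgroup.mem_zpowers _), rfl⟩
  have hwS : ((c : G)⁻¹ * g) * z * ((c : G)⁻¹ * g)⁻¹ ∈ (S : Subgroup C).map C.subtype :=
    ⟨_, hc _ (Subgroup.mem_zpowers _), by simp [mul_assoc]⟩
  have hfix : fixedBy Ω (((c : G)⁻¹ * g) * z * ((c : G)⁻¹ * g)⁻¹) = ((c : G)⁻¹ * g) • Δ := by
    rw [← smul_fixedBy, hzΔ]
  have hcomm := Subgroup.mem_centralizer_singleton_iff.1 c.2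
  refine ⟨(c : G)⁻¹ * g, ?_, ?_⟩
  · rw [mem_stabilizer_iff, ← hfix, ← hzΔ]
    refine (fixedBy_eq_of_mem_isPGroup P hfree (S.isPGroup'.map _) hzS hwS hz1
      (fun h => hz1 (conj_eq_one_iff.1 h)) (by rw [hzΔ]) ?_).symm
    rw [hfix, Set.ncard_smul_set]
  · calc (c : G)⁻¹ * g * x * ((c : G)⁻¹ * g)⁻¹ = (c : G)⁻¹ * (y * c) := by rw [hy]; group
      _ = y := by rw [← hcomm]; group

/-- If every element of order `p` in `N ⊓ P` fixes exactly the points of `Δ`, where `P` lies in the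
setwise stabilizer `K` of `Δ` and `N` is normal, then `N ⊓ K` is strongly `p`-embedded in `N`. -/
lemma stronglyPEmbeddedIn_of_fixedBy_eq (hPΔ : (P : Subgroup G) ≤ stabilizer G Δ)
    (N : Subgroup G) [N.Normal] {w : G} (hwP : w ∈ P) (hwN : w ∈ N) (hw1 : w ≠ 1)
    (hN : ∀ y ∈ N, y ∈ P → orderOf y = p → fixedBy Ω y = Δ) :
    StronglyPEmbeddedIn p (N ⊓ stabilizer G Δ) N := by
  have hK : ∀ y ∈ N, y ∈ stabilizer G Δ → orderOf y = p → fixedBy Ω y = Δ := by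
    intro y hyN hyK hy
    have hS : IsPGroup p (Subgroup.zpowers (⟨y, hyK⟩ : stabilizer G Δ)) := by
      apply IsPGroup.of_card (n := 1)
      rw [Nat.card_zpowers, Subgroup.orderOf_mk, hy, pow_one]
    obtain ⟨h, hh⟩ := hS.exists_conj_mem_sylow (P.subtype hPΔ)
    have h1 : (h : G)⁻¹ * y * h ∈ P := hh _ (Subgroup.mem_zpowers _)
    have h2 : (h : G)⁻¹ * y * h = MulAut.conj (h : G)⁻¹ y := by simp
    have h3 : orderOf ((h : G)⁻¹ * y * h) = p := by
      rw [h2, MulEquiv.orderOf_eq, hy]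
    have h4 : fixedBy Ω ((h : G)⁻¹ * y * h) = Δ := by
      refine hN _ ?_ h1 h3
      simpa using ‹N.Normal›.conj_mem y hyN (h : G)⁻¹
    calc fixedBy Ω y = (h : G) • fixedBy Ω ((h : G)⁻¹ * y * h) := by
          rw [smul_fixedBy]
          congr 1
          group
      _ = Δ := by rw [h4]; exact h.2
  refine ⟨inf_le_left, ?_, fun g hgN hgK hdvd => hgK ⟨hgN, ?_⟩⟩
  · have h1 : p ∣ orderOf (⟨w, hwP⟩ : P) :=
      P.isPGroup'.dvd_orderOf fun h => hw1 (congrArg Subtype.val h)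
    rw [Subgroup.orderOf_mk] at h1
    exact h1.trans (Subgroup.orderOf_dvd_natCard _ ⟨hwN, hPΔ hwP⟩)
  · obtain ⟨⟨y, hyM⟩, hy⟩ := exists_prime_orderOf_dvd_card' p hdvd
    rw [Subgroup.orderOf_mk] at hy
    obtain ⟨⟨hyN, hyK⟩, v, ⟨hvN, hvK⟩, rfl⟩ := hyM
    have hv : orderOf v = p := by
      rw [← hy]
      exact ((MulAut.conj g).orderOf_eq v).symm
    have h1 := hK _ hyN hyK hy
    change fixedBy Ω (g * v * g⁻¹) = Δ at h1
    rw [← smul_fixedBy, hK v hvN hvK hv] at h1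
    exact h1

end SylowAction

/-- A normal subgroup of prime index is the kernel of a homomorphism to a commutative group of
prime order. -/
lemma Subgroup.exists_ker_eq_of_index_prime {H : Type u} [Group H] (M : Subgroup H) [M.Normal]
    {p : ℕ} [Fact p.Prime] (hM : M.index = p) :
    ∃ (A : Type u) (_ : CommGroup A) (φ : H →* A), Nat.card A = p ∧ φ.ker = M := by
  have hcyc : IsCyclic (H ⧸ M) := isCyclic_of_prime_card (p := p) hM
  exact ⟨H ⧸ M, IsCyclic.commGroup, QuotientGroup.mk' M, hM, QuotientGroup.ker_mk' M⟩

/-- Nontrivial elements of a group of order three are equal or mutually inverse. -/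
lemma eq_or_mul_eq_one_of_card_eq_three {A : Type*} [Group A] (hA : Nat.card A = 3) {a b : A}
    (ha : a ≠ 1) (hb : b ≠ 1) : b = a ∨ b * a = 1 := by
  have : Finite A := Nat.finite_of_card_ne_zero (by omega)
  have : Fact (Nat.Prime 3) := ⟨Nat.prime_three⟩
  have ho : orderOf a = 3 := orderOf_eq_prime (by rw [← hA, pow_card_eq_one']) ha
  have hba : b ∈ Submonoid.powers a := mem_powers_of_prime_card hA ha
  classical
  rw [mem_powers_iff_mem_range_orderOf, ho] at hba
  obtain ⟨n, hn, rfl⟩ := Finset.mem_image.1 hba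
  have hn3 := Finset.mem_range.1 hn
  interval_cases n
  · simp at hb
  · simp
  · right
    rw [← pow_succ]
    exact orderOf_dvd_iff_pow_eq_one.1 (dvd_of_eq ho)

/-- Let `P` act on an orbit of length three through a group of order three. If an element `k`
preserves this orbit and inverts the action of `P` on it, then `k` fixes a point of the orbit and
has even order. -/
lemma exists_even_card_stabilizer {G Ω A : Type*} [Group G] [Finite G] [MulAction G Ω] [Group A]
    (hA : Nat.card A = 3) {P : Subgroup G} (φ : P →* A) {t : Ω}
    (hφ : ∀ u : P, φ u = 1 ↔ u • t = t) {x y q : P} {k : G} (hx : φ x ≠ 1) (hyx : φ y * φ x = 1)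
    (hk : k * x * k⁻¹ = y) (hkt : k • t = q • t) :
    ∃ ω : Ω, Even (Nat.card (stabilizer G ω)) := by
  have : Fact (Nat.Prime 3) := ⟨Nat.prime_three⟩
  have hφ' : ∀ u v : P, φ u = φ v ↔ u • t = v • t := by
    intro u v
    rw [← inv_mul_eq_one, ← map_inv, ← map_mul, hφ, mul_smul, inv_smul_eq_iff, eq_comm]
  have hx3 : φ x ^ 3 = 1 := by rw [← hA, pow_card_eq_one']
  obtain ⟨i, hi⟩ := Subgroup.mem_zpowers_iff.1
    (mem_zpowers_of_prime_card (g := φ x) (g' := φ q) hA hx)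
  have hkx : ∀ j : ℤ, k • x ^ (2 * i + j) • t = x ^ (2 * i - j) • t := by
    intro j
    have h1 : k • x ^ (2 * i + j) • t = (y ^ (2 * i + j) * q) • t := by
      rw [mul_smul, ← hkt, Subgroup.smul_def, Subgroup.smul_def, smul_smul, smul_smul,
        Subgroup.coe_zpow, Subgroup.coe_zpow, ← hk, conj_zpow]
      group
    rw [h1, ← hφ', map_mul, map_zpow, map_zpow, ← hi, eq_inv_of_mul_eq_one_left hyx, inv_zpow',
      ← zpow_add, ← mul_inv_eq_one, ← zpow_neg, ← zpow_add]
    have h2 : -(2 * i + j) + i + -(2 * i - j) = ((3 : ℕ) : ℤ) * -i := by push_cast; ring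
    rw [h2, zpow_mul, zpow_natCast, hx3, one_zpow]
  refine ⟨x ^ (2 * i) • t, ?_⟩
  by_contra hodd
  rw [Nat.not_even_iff_odd] at hodd
  obtain ⟨m, hm⟩ := hodd
  have hkω : k ∈ stabilizer G (x ^ (2 * i) • t) := by simpa using hkx 0
  have hk1 : k ^ (2 * m + 1) = 1 := by
    rw [← hm]
    exact congrArg Subtype.val (pow_card_eq_one' (x := (⟨k, hkω⟩ : stabilizer G _)))
  have hsq : ∀ n : ℕ, (k ^ 2) ^ n • x ^ (2 * i + 1) • t = x ^ (2 * i + 1) • t := by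
    intro n
    induction n with
    | zero => simp
    | succ n ih =>
      rw [pow_succ, mul_smul, sq k, mul_smul, ← sq, hkx 1]
      have := hkx (-1)
      rw [← sub_eq_add_neg, sub_neg_eq_add] at this
      rw [this, ih]
  have h1 : x ^ (2 * i + 1) • t = x ^ (2 * i - 1) • t := by
    rw [← hkx 1]
    conv_lhs => rw [← one_smul G (x ^ (2 * i + 1) • t), ← hk1, pow_succ', mul_smul, pow_mul, hsq]
  rw [← hφ', map_zpow, map_zpow, zpow_add, zpow_sub, mul_right_inj, zpow_one,
    eq_inv_iff_mul_eq_one] at h1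
  apply hx
  rw [← hx3, pow_succ, pow_two, h1, one_mul]

end FixedPoints


/-- With `G`, `Ω`, `P`, `Δ`, `K` as in the fixity-4 situation where
`1 ≤ |Δ| ≤ 4` and `P` acts freely on `Ω ∖ Δ`: either `K` is strongly 3-embedded in
`G`, or `G` has a normal subgroup `N` of index 3 with `N ∩ K` strongly 3-embedded in
`N`, or all point stabilizers have even order. -/
theorem stmt_11 {G : Type*} [Group G] [Finite G] {Ω : Type*} [Finite Ω] [MulAction G Ω]
    [MulAction.IsPretransitive G Ω] [FaithfulSMul G Ω]
    (hfix : ∀ g : G, g ≠ 1 → Set.ncard {ω : Ω | g • ω = ω} ≤ 4)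
    (hfix4 : ∃ g : G, g ≠ 1 ∧ Set.ncard {ω : Ω | g • ω = ω} = 4)
    (P : Sylow 3 G)
    (Δ : Set Ω)
    (hΔ : Δ = {ω : Ω | Set.ncard (MulAction.orbit ↥(P : Subgroup G) ω) ≤ 3})
    (hΔ1 : 1 ≤ Δ.ncard) (hΔ4 : Δ.ncard ≤ 4)
    (hfree : ∀ ω : Ω, ω ∉ Δ → ∀ g ∈ (P : Subgroup G), g • ω = ω → g = 1)
    (K : Subgroup G) (hK : K = MulAction.stabilizer G Δ) :
    StronglyPEmbeddedIn 3 K ⊤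
      ∨ (∃ N : Subgroup G, N.Normal ∧ N.index = 3 ∧ StronglyPEmbeddedIn 3 (N ⊓ K) N)
      ∨ (∀ α : Ω, Even (Nat.card ↥(MulAction.stabilizer G α))) := by
  have h3 : Fact (Nat.Prime 3) := ⟨Nat.prime_three⟩
  have hmemΔ : ∀ ω, ω ∈ Δ ↔ (MulAction.orbit (P : Subgroup G) ω).ncard ≤ 3 := fun ω => by
    rw [hΔ, Set.mem_ofPred_eq]
  have hPmem : ∀ g ∈ (P : Subgroup G), ∀ ω ∈ Δ, g • ω ∈ Δ := by
    intro g hg ω hω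
    rw [hmemΔ] at hω ⊢
    have : MulAction.orbit (P : Subgroup G) (g • ω) = MulAction.orbit (P : Subgroup G) ω :=
      MulAction.orbit_eq_iff.2 ⟨⟨g, hg⟩, rfl⟩
    rwa [this]
  have hPK : (P : Subgroup G) ≤ MulAction.stabilizer G Δ := by
    intro g hg
    rw [MulAction.mem_stabilizer_set_iff_smul_set_subset (Set.toFinite _)]
    rintro _ ⟨ω, hω, rfl⟩
    exact hPmem g hg ω hω
  obtain ⟨ω₀, hω₀⟩ : ∃ ω₀, ω₀ ∉ Δ := by
    by_contra! hall
    obtain ⟨g, hg1, hg4⟩ := hfix4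
    have h1 : {ω : Ω | g • ω = ω} = Δ := Set.eq_of_subset_of_ncard_le (fun ω _ => hall ω)
      (hΔ4.trans hg4.ge) (Set.toFinite _)
    refine hg1 (FaithfulSMul.eq_of_smul_eq_smul (α := Ω) fun ω => ?_)
    rw [one_smul]
    exact h1.ge (hall ω)
  have hPcard : 3 < Nat.card (P : Subgroup G) := by
    rw [hmemΔ, ← MulAction.index_stabilizer, not_le] at hω₀
    exact hω₀.trans_le (Nat.le_of_dvd Nat.card_pos (Subgroup.index_dvd_card _))
  have hfixΔ : ∀ u ∈ (P : Subgroup G), u ≠ 1 → (∀ ω ∈ Δ, u • ω = ω) →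
      MulAction.fixedBy Ω u = Δ := by
    intro u hu hu1 huΔ
    refine Set.Subset.antisymm (fun ω hω => ?_) huΔ
    by_contra hn
    exact hu1 (hfree ω hn u hu hω)
  have hP1 : Nontrivial (P : Subgroup G) := Finite.one_lt_card_iff_nontrivial.1 (by omega)
  obtain ⟨⟨w₀, hw₀P⟩, hw₀⟩ := exists_ne (1 : (P : Subgroup G))
  have hw₀1 : w₀ ≠ 1 := fun h => hw₀ (Subtype.ext h)
  have horder : ∀ u : G, orderOf u = 3 → u ≠ 1 := by
    rintro u hu rfl
    simp at hu
  have hembed : (∀ y ∈ (P : Subgroup G), orderOf y = 3 → MulAction.fixedBy Ω y = Δ) →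
      StronglyPEmbeddedIn 3 K ⊤ := by
    intro h
    have := stronglyPEmbeddedIn_of_fixedBy_eq P hPK ⊤ hw₀P (Subgroup.mem_top _) hw₀1
      fun y _ => h y
    rwa [top_inf_eq, ← hK] at this
  by_cases hA : ∀ g ∈ (P : Subgroup G), ∀ ω ∈ Δ, g • ω = ω
  · exact Or.inl (hembed fun y hy ho => hfixΔ y hy (horder y ho) (hA y hy))
  push Not at hA
  obtain ⟨g₀, hg₀, t, htΔ, hg₀t⟩ := hA
  have horb : ∀ ω ∈ Δ, (∃ g ∈ (P : Subgroup G), g • ω ≠ ω) →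
      (MulAction.orbit (P : Subgroup G) ω).ncard = 3 := by
    rintro ω hω ⟨g, hg, hgω⟩
    rw [hmemΔ] at hω
    obtain ⟨n, hn⟩ := P.isPGroup'.index (MulAction.stabilizer (P : Subgroup G) ω)
    rw [MulAction.index_stabilizer] at hn
    match n with
    | 0 =>
      exfalso
      rw [pow_zero, ← MulAction.index_stabilizer, Subgroup.index_eq_one] at hn
      have : (⟨g, hg⟩ : (P : Subgroup G)) ∈ MulAction.stabilizer (P : Subgroup G) ω := by
        rw [hn]
        exact Subgroup.mem_top _
      exact hgω this
    | 1 => simpa using hn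
    | n + 2 =>
      have : 1 ≤ 3 ^ n := Nat.one_le_pow _ _ (by norm_num)
      rw [pow_add] at hn
      omega
  have ht3 := horb t htΔ ⟨g₀, hg₀, hg₀t⟩
  let M := MulAction.stabilizer (P : Subgroup G) t
  have hM3 : M.index = 3 := by rw [MulAction.index_stabilizer, ht3]
  have hMn : M.Normal := by
    obtain ⟨n, hn⟩ := IsPGroup.iff_card.1 P.isPGroup'
    have hn0 : n ≠ 0 := by
      rintro rfl
      rw [hn] at hPcard
      omega
    exact Subgroup.normal_of_index_eq_minFac_card
      (by rw [hM3, hn, Nat.prime_three.pow_minFac hn0])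
  have horbΔ : ∀ ω ∈ Δ, MulAction.orbit (P : Subgroup G) ω ⊆ Δ := by
    rintro ω hω _ ⟨u, rfl⟩
    exact hPmem u u.2 ω hω
  have hout : ∀ ω ∈ Δ, ω ∉ MulAction.orbit (P : Subgroup G) t →
      ∀ g ∈ (P : Subgroup G), g • ω = ω := by
    intro ω hω hωt g hg
    by_contra hgω
    have h1 := horb ω hω ⟨g, hg, hgω⟩
    have hdisj : Disjoint (MulAction.orbit (P : Subgroup G) ω)
        (MulAction.orbit (P : Subgroup G) t) := by
      refine (MulAction.orbit.eq_or_disjoint ω t).resolve_left fun h => hωt ?_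
      rw [← h]
      exact MulAction.mem_orbit_self ω
    have h2 := Set.ncard_le_ncard (Set.union_subset (horbΔ ω hω) (horbΔ t htΔ)) (Set.toFinite _)
    rw [Set.ncard_union_eq hdisj (Set.toFinite _) (Set.toFinite _)] at h2
    omega
  have hMfix : ∀ u : (P : Subgroup G), u ∈ M → u ≠ 1 → MulAction.fixedBy Ω (u : G) = Δ := by
    intro u hu hu1
    refine hfixΔ u u.2 (fun h => hu1 (Subtype.ext h)) fun ω hω => ?_
    by_cases hωt : ω ∈ MulAction.orbit (P : Subgroup G) t
    · obtain ⟨v, rfl⟩ := hωt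
      have h1 : v⁻¹ * u * v ∈ M := by simpa using hMn.conj_mem u hu v⁻¹
      have h2 : (v⁻¹ * u * v) • t = t := h1
      rw [mul_smul, mul_smul, inv_smul_eq_iff] at h2
      exact h2
    · exact hout ω hω hωt u u.2
  have hMcard : 3 ∣ Nat.card M := by
    refine (P.isPGroup'.to_subgroup M).card_eq_or_dvd.resolve_left fun h => ?_
    have := M.card_mul_index
    rw [h, hM3] at this
    omega
  obtain ⟨z, hzM, hz1, hzc⟩ := P.isPGroup'.exists_mem_center_of_normal M hMcard
  by_cases heven : ∃ ω : Ω, Even (Nat.card (MulAction.stabilizer G ω))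
  · right
    right
    intro α
    obtain ⟨ω, hω⟩ := heven
    obtain ⟨g, rfl⟩ := MulAction.exists_smul_eq G ω α
    rwa [← Nat.card_congr (MulAction.stabilizerEquivStabilizer (rfl : g • ω = g • ω)).toEquiv]
  obtain ⟨A, _, φ, hAcard, hker⟩ := M.exists_ker_eq_of_index_prime hM3
  have hφ : ∀ u : (P : Subgroup G), φ u = 1 ↔ u • t = t := fun u => by
    rw [← MonoidHom.mem_ker, hker, MulAction.mem_stabilizer_iff]
  have hfusion : ∀ x : (P : Subgroup G), φ x ≠ 1 → ∀ (g : G)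
      (hg : g⁻¹ * (x : G) * g ∈ (P : Subgroup G)), φ ⟨_, hg⟩ = φ x := by
    intro x hx g hg
    obtain ⟨k, hkΔ, hk⟩ := exists_mem_stabilizer_conj_eq P hfree z.2
      (fun h => hz1 (Subtype.ext h)) (fun x hx => congrArg Subtype.val (hzc ⟨x, hx⟩))
      (hMfix z hzM hz1) x.2 (g := g⁻¹) (by rw [inv_inv]; exact hg)
    rw [inv_inv] at hk
    set y : (P : Subgroup G) := ⟨_, hg⟩ with hy
    have hky : k * x * k⁻¹ = y := hk
    have hkx : ∀ ω : Ω, y • k • ω = k • x • ω := by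
      intro ω
      rw [Subgroup.smul_def, ← hky, Subgroup.smul_def, smul_smul, smul_smul, inv_mul_cancel_right]
    have hktΔ : k • t ∈ Δ := by
      have := Set.smul_mem_smul_set (a := k) htΔ
      rwa [hkΔ] at this
    have hmove : y • k • t ≠ k • t := by
      rw [hkx, Ne, smul_left_cancel_iff, ← hφ]
      exact hx
    have hkt : k • t ∈ MulAction.orbit (P : Subgroup G) t := by
      by_contra hn
      exact hmove (hout _ hktΔ hn y y.2)
    have hy1 : φ y ≠ 1 := by
      intro h
      have hyM : y ∈ M := (hφ y).1 h
      have : y ≠ 1 := by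
        intro h
        rw [h, one_smul] at hmove
        exact hmove rfl
      exact hmove ((hMfix y hyM this).ge hktΔ)
    refine (eq_or_mul_eq_one_of_card_eq_three hAcard hx hy1).resolve_right fun h => ?_
    obtain ⟨q, hq⟩ := hkt
    exact heven (exists_even_card_stabilizer hAcard φ hφ hx h hky hq.symm)
  by_cases hx : ∃ x : (P : Subgroup G), φ x ≠ 1 ∧ orderOf (x : G) = 3
  swap
  · push Not at hx
    refine Or.inl (hembed fun y hy ho => ?_)
    by_cases h : φ ⟨y, hy⟩ = 1
    · exact hMfix ⟨y, hy⟩ ((hφ _).1 h) fun h => horder y ho (congrArg Subtype.val h)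
    · exact absurd ho (hx ⟨y, hy⟩ h)
  right
  left
  have hA3 : ∀ a : A, a ^ 3 = 1 := fun a => by rw [← hAcard, pow_card_eq_one']
  have htransfer : ∀ x : (P : Subgroup G), φ x ≠ 1 → orderOf (x : G) = 3 →
      φ.transfer (x : G) ≠ 1 := by
    intro x hx ho h
    have hx3 : x ^ 3 = 1 := Subtype.ext (orderOf_dvd_iff_pow_eq_one.1 (dvd_of_eq ho))
    rw [φ.transfer_eq_pow_index hA3 x hx3 (hfusion x hx), ← orderOf_dvd_iff_pow_eq_one,
      orderOf_eq_prime (hA3 _) hx] at h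
    exact P.not_dvd_index h
  obtain ⟨x, hx, hxo⟩ := hx
  refine ⟨φ.transfer.ker, inferInstance, ?_, ?_⟩
  · rw [Subgroup.index_ker]
    have h1 := Subgroup.card_subgroup_dvd_card φ.transfer.range
    rw [hAcard, Nat.dvd_prime Nat.prime_three] at h1
    refine h1.resolve_left fun h => htransfer x hx hxo ?_
    rw [Subgroup.card_eq_one] at h
    have : φ.transfer (x : G) ∈ φ.transfer.range := ⟨_, rfl⟩
    rwa [h, Subgroup.mem_bot] at this
  · obtain ⟨w, hw, hw1⟩ : ∃ w : (P : Subgroup G), φ.transfer (w : G) = 1 ∧ w ≠ 1 := by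
      by_contra! h
      have hinj : Function.Injective (φ.transfer.comp (P : Subgroup G).subtype) :=
        (injective_iff_map_eq_one _).2 h
      have : Finite A := Nat.finite_of_card_ne_zero (by omega)
      have := Nat.card_le_card_of_injective _ hinj
      omega
    rw [hK]
    refine stronglyPEmbeddedIn_of_fixedBy_eq P hPK _ w.2 hw (fun h => hw1 (Subtype.ext h)) ?_
    intro y hyN hyP ho
    refine hMfix ⟨y, hyP⟩ ((hφ _).1 ?_) fun h => horder y ho (congrArg Subtype.val h)
    by_contra h
    exact htransfer ⟨y, hyP⟩ h ho hyN
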